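/- arXiv:1404.3154 — 3 statements merged into one kernel-verified Lean document; each statement's English description precedes it below -/
import Mathlib

section
/- Let A : ℝ⁴ → ℝ⁴ be an invertible linear map and let 𝒢 = ℝ × ℝ⁴ be the Lie algebra with bracket [(x,v),(y,w)] = (0, x·A(w) − y·A(v)). Then for every linear functional F : 𝒢 → ℝ, the skew-symmetric bilinear form B_F on 𝒢 defined by B_F(X,Y) = F([X,Y]) has rank 0 or rank 2; moreover B_F has rank 0 if and only if F vanishes on the subspace {0} × ℝ⁴. (Consequently, for each of the Lie algebras 𝒢₅,₄,... above, every coadjoint orbit has dimension 0 or dimension 2.) -/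
noncomputable section

/-- The Lie bracket of `𝒢 = ℝ × ℝ⁴` determined by an invertible linear map `A : ℝ⁴ → ℝ⁴`:
`[(x,v),(y,w)] = (0, x·A(w) − y·A(v))`. -/
def br (A : (Fin 4 → ℝ) →ₗ[ℝ] (Fin 4 → ℝ)) :
    (ℝ × (Fin 4 → ℝ)) → (ℝ × (Fin 4 → ℝ)) → (ℝ × (Fin 4 → ℝ)) :=
  fun X Y => (0, X.1 • A Y.2 - Y.1 • A X.2)

/-- The skew-symmetric bilinear form `B_F(X,Y) = F([X,Y])` attached to a linear
functional `F` on `𝒢`. -/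
def BF (A : (Fin 4 → ℝ) →ₗ[ℝ] (Fin 4 → ℝ)) (F : (ℝ × (Fin 4 → ℝ)) →ₗ[ℝ] ℝ) :
    (ℝ × (Fin 4 → ℝ)) → (ℝ × (Fin 4 → ℝ)) → ℝ :=
  fun X Y => F (br A X Y)

/-- The rank of the bilinear form `B_F`: the dimension of the span (inside the space of
real-valued functions on `𝒢`) of the family of partial maps `B_F(X,·)`, i.e. the rank of the
induced linear map from `𝒢` to its dual. -/
def rankBF (A : (Fin 4 → ℝ) →ₗ[ℝ] (Fin 4 → ℝ)) (F : (ℝ × (Fin 4 → ℝ)) →ₗ[ℝ] ℝ) : ℕ :=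
  Module.finrank ℝ (Submodule.span ℝ (Set.range fun X => BF A F X))

theorem BF_apply (A : (Fin 4 → ℝ) →ₗ[ℝ] (Fin 4 → ℝ)) (F : (ℝ × (Fin 4 → ℝ)) →ₗ[ℝ] ℝ)
    (X Y : ℝ × (Fin 4 → ℝ)) :
    BF A F X Y = X.1 * F (0, A Y.2) - Y.1 * F (0, A X.2) := by
  have h : br A X Y = X.1 • ((0 : ℝ), A Y.2) - Y.1 • ((0 : ℝ), A X.2) := by
    ext <;> simp [br]
  simp only [BF, h, map_sub, map_smul, smul_eq_mul]

theorem rankBF_eq_zero {A : (Fin 4 → ℝ) →ₗ[ℝ] (Fin 4 → ℝ)} {F : (ℝ × (Fin 4 → ℝ)) →ₗ[ℝ] ℝ}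
    (hF : ∀ v, F (0, v) = 0) : rankBF A F = 0 := by
  have h : (fun X => BF A F X) = fun _ => 0 := by
    ext X Y
    simp [BF_apply, hF]
  rw [rankBF, h, Set.range_const, Submodule.span_zero_singleton, finrank_bot]

theorem span_range_BF {A : (Fin 4 → ℝ) →ₗ[ℝ] (Fin 4 → ℝ)} {F : (ℝ × (Fin 4 → ℝ)) →ₗ[ℝ] ℝ}
    {u : Fin 4 → ℝ} (hu : F (0, A u) ≠ 0) :
    Submodule.span ℝ (Set.range fun X => BF A F X) =
      Submodule.span ℝ (Set.range ![BF A F (1, 0), BF A F (0, u)]) := by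
  apply le_antisymm <;> rw [Submodule.span_le]
  · rintro _ ⟨X, rfl⟩
    rw [Matrix.range_cons_cons_empty, SetLike.mem_coe, Submodule.mem_span_pair]
    refine ⟨X.1, F (0, A X.2) / F (0, A u), ?_⟩
    ext Y
    have h₀ : F (0, 0) = 0 := map_zero F
    simp only [BF_apply, Pi.add_apply, Pi.smul_apply, smul_eq_mul, map_zero, h₀]
    field_simp
    ring
  · rintro _ ⟨i, rfl⟩
    fin_cases i <;> exact Submodule.subset_span ⟨_, rfl⟩

theorem linearIndependent_BF {A : (Fin 4 → ℝ) →ₗ[ℝ] (Fin 4 → ℝ)}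
    {F : (ℝ × (Fin 4 → ℝ)) →ₗ[ℝ] ℝ} {u : Fin 4 → ℝ} (hu : F (0, A u) ≠ 0) :
    LinearIndependent ℝ ![BF A F (1, 0), BF A F (0, u)] := by
  rw [LinearIndependent.pair_iff]
  intro s t h
  have h₁ := congrFun h (0, u)
  have h₂ := congrFun h (1, 0)
  exact ⟨by simpa [BF_apply, hu] using h₁, by simpa [BF_apply, hu] using h₂⟩

theorem rankBF_eq_two {A : (Fin 4 → ℝ) →ₗ[ℝ] (Fin 4 → ℝ)} {F : (ℝ × (Fin 4 → ℝ)) →ₗ[ℝ] ℝ}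
    {u : Fin 4 → ℝ} (hu : F (0, A u) ≠ 0) : rankBF A F = 2 := by
  rw [rankBF, span_range_BF hu, finrank_span_eq_card (linearIndependent_BF hu), Fintype.card_fin]

theorem rank_BF_zero_or_two (A : (Fin 4 → ℝ) →ₗ[ℝ] (Fin 4 → ℝ)) (hA : Function.Bijective A)
    (F : (ℝ × (Fin 4 → ℝ)) →ₗ[ℝ] ℝ) :
    -- `B_F` is skew-symmetric
    (∀ X Y : ℝ × (Fin 4 → ℝ), BF A F Y X = - BF A F X Y) ∧
    -- `B_F` has rank `0` or rank `2`
    (rankBF A F = 0 ∨ rankBF A F = 2) ∧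
    -- `B_F` has rank `0` iff `F` vanishes on `{0} × ℝ⁴`
    (rankBF A F = 0 ↔ ∀ v : Fin 4 → ℝ, F (0, v) = 0) := by
  refine ⟨fun X Y => by rw [BF_apply, BF_apply]; ring, ?_⟩
  by_cases hF : ∀ v, F (0, v) = 0
  · exact ⟨Or.inl (rankBF_eq_zero hF), fun _ => hF, rankBF_eq_zero⟩
  · obtain ⟨v, hv⟩ := not_forall.mp hF
    obtain ⟨u, rfl⟩ := hA.surjective v
    have h := rankBF_eq_two hv
    exact ⟨Or.inr h, fun h₀ => by omega, fun h₀ => absurd h₀ hF⟩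
end
end

section
/- Let p = (x,w,t,s) ∈ V. If (t,s) ≠ (0,0), then λ₁₂((r,a),p) = p holds if and only if (r,a) = (0,0) (the stabilizer of p is trivial). If t = s = 0 (so that w ≠ 0), then λ₁₂((r,a),p) = p holds if and only if r = 0 and a ∈ 2πℤ (the stabilizer of p is the discrete subgroup {0} × 2πℤ of ℝ²). -/
noncomputable section

/-- The action `λ₁₂` of `ℝ²` on `ℝ × ℂ × ℝ × ℝ`:
`λ₁₂((r,a),(x,w,t,s)) = (x + r, e^{−ia}·w, eᵃ·t, eᵃ·s)`. -/
def act12 (g : ℝ × ℝ) (p : ℝ × ℂ × ℝ × ℝ) : ℝ × ℂ × ℝ × ℝ :=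
  (p.1 + g.1, Complex.exp (-(g.2 : ℂ) * Complex.I) * p.2.1,
    Real.exp g.2 * p.2.2.1, Real.exp g.2 * p.2.2.2)

/-- `V = ℝ × (ℝ⁴ \ {0})`, i.e. the set of `(x,w,t,s)` with `(w,t,s) ≠ 0`. -/
def V : Set (ℝ × ℂ × ℝ × ℝ) := {p | p.2.1 ≠ 0 ∨ p.2.2.1 ≠ 0 ∨ p.2.2.2 ≠ 0}

theorem act12_stabilizers (p : ℝ × ℂ × ℝ × ℝ) (hp : p ∈ V) :
    -- if `(t,s) ≠ (0,0)` the stabilizer of `p` is trivial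
    (¬(p.2.2.1 = 0 ∧ p.2.2.2 = 0) →
      ∀ g : ℝ × ℝ, act12 g p = p ↔ g = (0, 0)) ∧
    -- if `t = s = 0` (so that `w ≠ 0`) the stabilizer of `p` is `{0} × 2πℤ`
    (p.2.2.1 = 0 → p.2.2.2 = 0 →
      ∀ g : ℝ × ℝ, act12 g p = p ↔ (g.1 = 0 ∧ ∃ k : ℤ, g.2 = 2 * Real.pi * k)) := by
  obtain ⟨x, w, t, s⟩ := p
  refine ⟨fun hts g => ?_, fun ht hs g => ?_⟩
  · obtain ⟨r, a⟩ := g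
    simp only [not_and_or] at hts
    simp only [act12, Prod.mk.injEq, add_eq_left]
    constructor
    · rintro ⟨hr, -, h₁, h₂⟩
      refine ⟨hr, Real.exp_eq_one_iff a |>.mp ?_⟩
      rcases hts with h | h
      · exact (mul_eq_right₀ h).mp h₁
      · exact (mul_eq_right₀ h).mp h₂
    · rintro ⟨rfl, rfl⟩
      simp
  · obtain ⟨r, a⟩ := g
    dsimp only at ht hs
    subst ht hs
    have hw : w ≠ 0 := by simpa [V] using hp
    simp only [act12, Prod.mk.injEq, add_eq_left, mul_zero, and_true, mul_eq_right₀ hw]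
    refine and_congr_right fun _ => ?_
    rw [neg_mul, Complex.exp_neg, inv_eq_one, Complex.exp_eq_one_iff]
    refine exists_congr fun k => ?_
    rw [← mul_assoc, mul_left_inj' Complex.I_ne_zero, mul_comm (k : ℂ)]
    exact_mod_cast Iff.rfl
end
end

section
/- Let p = (x,w,t,s) ∈ V with (t,s) ≠ (0,0). Then the orbit map θ_p : ℝ² → ℝ × ℂ × ℝ × ℝ, θ_p(r,a) = λ₁₂((r,a), p) = (x + r, e^{−ia}·w, e^{a}·t, e^{a}·s), is injective, continuous, and a homeomorphism onto its image; in particular the λ₁₂-orbit of p is homeomorphic to ℝ². -/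
noncomputable section

/-- The orbit map `θ_p(r,a) = λ₁₂((r,a),p)` of a point `p = (x,w,t,s)`. -/
def orbitMap (p : ℝ × ℂ × ℝ × ℝ) : ℝ × ℝ → ℝ × ℂ × ℝ × ℝ :=
  fun g => act12 g p

/-- The map `(r,a) ↦ (x + r, eᵃ·c)` is an embedding of the plane when `c ≠ 0`. -/
theorem isEmbedding_add_exp_mul (x : ℝ) {c : ℝ} (hc : c ≠ 0) :
    Topology.IsEmbedding fun g : ℝ × ℝ => (x + g.1, Real.exp g.2 * c) :=
  (Homeomorph.addLeft x).isEmbedding.prodMap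
    ((Homeomorph.mulRight₀ c hc).isEmbedding.comp Real.isOpenEmbedding_exp.isEmbedding)

theorem continuous_orbitMap (p : ℝ × ℂ × ℝ × ℝ) : Continuous (orbitMap p) := by
  unfold orbitMap act12
  fun_prop

theorem isEmbedding_orbitMap (p : ℝ × ℂ × ℝ × ℝ)
    (hts : ¬(p.2.2.1 = 0 ∧ p.2.2.2 = 0)) : Topology.IsEmbedding (orbitMap p) := by
  have hc : |p.2.2.1| + |p.2.2.2| ≠ 0 := by
    rwa [Ne, add_eq_zero_iff_of_nonneg (abs_nonneg _) (abs_nonneg _), abs_eq_zero, abs_eq_zero]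
  refine .of_comp (continuous_orbitMap p)
    (g := fun q : ℝ × ℂ × ℝ × ℝ => (q.1, |q.2.2.1| + |q.2.2.2|)) (by fun_prop) ?_
  convert isEmbedding_add_exp_mul p.1 hc using 1
  ext g <;> simp [orbitMap, act12, abs_mul, mul_add]

/-- For `p = (x,w,t,s)` with `(t,s) ≠ (0,0)`, the orbit map `θ_p` is injective, continuous
and a homeomorphism onto its image (with the subspace topology); in particular the
`λ₁₂`-orbit of `p` is homeomorphic to `ℝ²`. -/
theorem orbitMap_embedding (p : ℝ × ℂ × ℝ × ℝ)
    (hts : ¬(p.2.2.1 = 0 ∧ p.2.2.2 = 0)) :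
    Function.Injective (orbitMap p) ∧
    Continuous (orbitMap p) ∧
    Topology.IsEmbedding (orbitMap p) ∧
    Nonempty ((ℝ × ℝ) ≃ₜ (Set.range (orbitMap p))) := by
  have h := isEmbedding_orbitMap p hts
  exact ⟨h.injective, h.continuous, h, ⟨h.toHomeomorph⟩⟩
end
end
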